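/- Let A be a skew left brace. Define Γ̄₁(A) := A and Γ̄_n(A) := the subgroup of (A,·) generated by A*Γ̄_{n-1}(A) and [A,Γ̄_{n-1}(A)]·. Then for every n ≥ 1 one has Γ̄_n(A) ⊆ A_{(n-1)} ⊆ Γ_n(A). -/

import Mathlib

set_option linter.unusedVariables false

universe u v

/-- A skew left brace: a carrier with two group structures `(A,·)` (written `dmul`) and
`(A,∘)` (written `cmul`) sharing the same identity `ident`, satisfying
`a ∘ (b · c) = (a ∘ b) · a⁻¹ · (a ∘ c)`. -/
class SkewBrace (A : Type u) where
  dmul : A → A → A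
  ident : A
  dinv : A → A
  cmul : A → A → A
  cinv : A → A
  dmul_assoc : ∀ a b c : A, dmul (dmul a b) c = dmul a (dmul b c)
  ident_dmul : ∀ a : A, dmul ident a = a
  dmul_ident : ∀ a : A, dmul a ident = a
  dinv_dmul : ∀ a : A, dmul (dinv a) a = ident
  dmul_dinv : ∀ a : A, dmul a (dinv a) = ident
  cmul_assoc : ∀ a b c : A, cmul (cmul a b) c = cmul a (cmul b c)
  ident_cmul : ∀ a : A, cmul ident a = a
  cmul_ident : ∀ a : A, cmul a ident = a
  cinv_cmul : ∀ a : A, cmul (cinv a) a = ident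
  cmul_cinv : ∀ a : A, cmul a (cinv a) = ident
  compat : ∀ a b c : A, cmul a (dmul b c) = dmul (dmul (cmul a b) (dinv a)) (cmul a c)

namespace SkewBrace

variable {A : Type u} [SkewBrace A]

/-- The lambda map `λ_a(b) = a⁻¹ · (a ∘ b)`. -/
def lam (a b : A) : A := dmul (dinv a) (cmul a b)

/-- The star operation `a * b = λ_a(b) · b⁻¹`. -/
def bstar (a b : A) : A := dmul (lam a b) (dinv b)

/-- The dot commutator `[a,b]· = a · b · a⁻¹ · b⁻¹`. -/
def dcomm (a b : A) : A := dmul (dmul (dmul a b) (dinv a)) (dinv b)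

/-- The circle commutator `[a,b]∘ = a ∘ b ∘ ā ∘ b̄`. -/
def ccomm (a b : A) : A := cmul (cmul (cmul a b) (cinv a)) (cinv b)

/-- Membership in the subgroup of `(A,·)` generated by a subset. -/
inductive dclosure (S : Set A) : A → Prop
  | mem {x : A} : x ∈ S → dclosure S x
  | one : dclosure S ident
  | mul {x y : A} : dclosure S x → dclosure S y → dclosure S (dmul x y)
  | inv {x : A} : dclosure S x → dclosure S (dinv x)

/-- The subgroup of `(A,·)` generated by a subset, as a set. -/
def dcl (S : Set A) : Set A := {x | dclosure S x}

/-- Membership in the subgroup of `(A,∘)` generated by a subset. -/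
inductive cclosure (S : Set A) : A → Prop
  | mem {x : A} : x ∈ S → cclosure S x
  | one : cclosure S ident
  | mul {x y : A} : cclosure S x → cclosure S y → cclosure S (cmul x y)
  | inv {x : A} : cclosure S x → cclosure S (cinv x)

/-- The subgroup of `(A,∘)` generated by a subset, as a set. -/
def ccl (S : Set A) : Set A := {x | cclosure S x}

/-- The set `{x * y : x ∈ I, y ∈ J}` (star values). -/
def starSet (I J : Set A) : Set A := {x | ∃ a ∈ I, ∃ b ∈ J, x = bstar a b}

/-- The set of dot commutators `[a,b]·` with `a ∈ I`, `b ∈ J`. -/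
def dcommSet (I J : Set A) : Set A := {x | ∃ a ∈ I, ∃ b ∈ J, x = dcomm a b}

/-- The set of circle commutators `[a,b]∘` with `a ∈ I`, `b ∈ J`. -/
def ccommSet (I J : Set A) : Set A := {x | ∃ a ∈ I, ∃ b ∈ J, x = ccomm a b}

/-- The lower central series `Γ_n(A)` of the skew brace `A` (`Gamma A n = Γ_n(A)` for `n ≥ 1`):
`Γ₁(A) = A` and `Γ_n(A) = ⟨A * Γ_{n-1}(A), Γ_{n-1}(A) * A, [A,Γ_{n-1}(A)]·⟩·`. -/
def Gamma (A : Type u) [SkewBrace A] : ℕ → Set A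
  | 0 => Set.univ
  | 1 => Set.univ
  | (n+2) =>
      dcl (starSet Set.univ (Gamma A (n+1)) ∪ starSet (Gamma A (n+1)) Set.univ ∪
        dcommSet Set.univ (Gamma A (n+1)))

/-- The lower central series `γ_n(A,∘)` of the group `(A,∘)`
(`gammaCirc A n = γ_n(A,∘)` for `n ≥ 1`). -/
def gammaCirc (A : Type u) [SkewBrace A] : ℕ → Set A
  | 0 => Set.univ
  | 1 => Set.univ
  | (n+2) => ccl (ccommSet (gammaCirc A (n+1)) Set.univ)

/-- The series `Γ̄_n(A)`: `Γ̄₁(A) = A`, `Γ̄_n(A) = ⟨A * Γ̄_{n-1}(A), [A, Γ̄_{n-1}(A)]·⟩·`. -/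
def GammaBar (A : Type u) [SkewBrace A] : ℕ → Set A
  | 0 => Set.univ
  | 1 => Set.univ
  | (n+2) =>
      dcl (starSet Set.univ (GammaBar A (n+1)) ∪ dcommSet Set.univ (GammaBar A (n+1)))

/-- The annihilator series: `AnnS A n = Ann_n(A)`, with `Ann_0(A) = 1` and
`Ann_n(A) = {a | a*b, b*a, [a,b]· ∈ Ann_{n-1}(A) for all b}`. -/
def AnnS (A : Type u) [SkewBrace A] : ℕ → Set A
  | 0 => {ident}
  | (n+1) => {a | ∀ b : A, bstar a b ∈ AnnS A n ∧ bstar b a ∈ AnnS A n ∧ dcomm a b ∈ AnnS A n}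

/-- The alphabet `X = {γ·, γ̄·, *, *̄}` of brace commutator symbols. -/
inductive BWord : Type
  | g | gbar | s | sbar

/-- Evaluation of a single symbol of `X`. -/
def evalX : BWord → A → A → A
  | BWord.g => dcomm
  | BWord.gbar => fun a b => dcomm b a
  | BWord.s => bstar
  | BWord.sbar => fun a b => bstar b a

/-- `evalW e a n` is the value `m(a₀ a₁ ⋯ a_n)` of the degree-`n` brace commutator word
`m = (e 0)(e 1)⋯(e (n-1))` on the arguments `a 0, …, a n`:
`m(a₀ ⋯ a_n) = (e 0)(a₀, (e 1)(a₁, …, (e (n-1))(a_{n-1}, a_n)⋯))`. -/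
def evalW : (ℕ → BWord) → (ℕ → A) → ℕ → A
  | _, a, 0 => a 0
  | e, a, (n+1) => evalX (e 0) (a 0) (evalW (fun i => e (i+1)) (fun i => a (i+1)) n)

/-- `Asub A t = A_{(t)}`, the subgroup of `(A,·)` generated by all values of brace commutator
words of degree `≥ t`. -/
def Asub (A : Type u) [SkewBrace A] (t : ℕ) : Set A :=
  dcl {x | ∃ s : ℕ, t ≤ s ∧ ∃ (e : ℕ → BWord) (a : ℕ → A), x = evalW e a s}

/-- `Sset A r = S_r(A)`, the set of all values of brace commutator words of degree exactly `r`
(`S_0(A) = A`). -/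
def Sset (A : Type u) [SkewBrace A] (r : ℕ) : Set A :=
  {x | ∃ (e : ℕ → BWord) (a : ℕ → A), x = evalW e a r}

/-- `cosetRel I a b` says that `b` lies in the coset `I · a`. -/
def cosetRel (I : Set A) (a b : A) : Prop := ∃ c ∈ I, b = dmul c a

/-- The class `I_n`: the maps `φ_m : (A/Ann_n(A))^{n+1} → A_{(n)}`,
`(Ann_n(A)a₁, …, Ann_n(A)a_{n+1}) ↦ m(a₁⋯a_{n+1})`, are well defined for every word `m` of
degree `n`. -/
def InClass (A : Type u) [SkewBrace A] (n : ℕ) : Prop :=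
  ∀ (e : ℕ → BWord) (a b : ℕ → A),
    (∀ i : ℕ, i ≤ n → cosetRel (AnnS A n) (a i) (b i)) →
    evalW e b n = evalW e a n

/-- A skew left brace `(A,·,∘)` is symmetric if `(A,∘,·)` is also a skew left brace, i.e.
`a · (b ∘ c) = (a · b) ∘ ā ∘ (a · c)`. -/
def IsSymmetric (A : Type u) [SkewBrace A] : Prop :=
  ∀ a b c : A, dmul a (cmul b c) = cmul (cmul (dmul a b) (cinv a)) (dmul a c)

/-- A sub-skew brace: a subset which is a subgroup of both `(A,·)` and `(A,∘)`. -/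
structure IsSubBrace (A : Type u) [SkewBrace A] (S : Set A) : Prop where
  ident_mem : ident ∈ S
  dmul_mem : ∀ {x y : A}, x ∈ S → y ∈ S → dmul x y ∈ S
  dinv_mem : ∀ {x : A}, x ∈ S → dinv x ∈ S
  cmul_mem : ∀ {x y : A}, x ∈ S → y ∈ S → cmul x y ∈ S
  cinv_mem : ∀ {x : A}, x ∈ S → cinv x ∈ S

/-- An ideal of a skew brace: a subgroup of `(A,·)`, normal in `(A,·)` and `(A,∘)`,
and invariant under all `λ_a`. -/
structure IsIdeal (A : Type u) [SkewBrace A] (I : Set A) : Prop where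
  ident_mem : ident ∈ I
  dmul_mem : ∀ {x y : A}, x ∈ I → y ∈ I → dmul x y ∈ I
  dinv_mem : ∀ {x : A}, x ∈ I → dinv x ∈ I
  dconj_mem : ∀ (a : A) {x : A}, x ∈ I → dmul (dmul a x) (dinv a) ∈ I
  cconj_mem : ∀ (a : A) {x : A}, x ∈ I → cmul (cmul a x) (cinv a) ∈ I
  lam_mem : ∀ (a : A) {x : A}, x ∈ I → lam a x ∈ I

/-- A homomorphism of skew braces. -/
structure IsBraceHom {A : Type u} {B : Type v} [SkewBrace A] [SkewBrace B] (f : A → B) : Prop where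
  map_dmul : ∀ x y : A, f (dmul x y) = dmul (f x) (f y)
  map_cmul : ∀ x y : A, f (cmul x y) = cmul (f x) (f y)

/-- The data of an isoclinism of skew braces along ideals `I` of `A` and `J` of `B`:
`ξ` induces a brace isomorphism `A/I → B/J` and `θ` restricts to a brace isomorphism
`Γ₂(A) → Γ₂(B)` compatible with the commutator and star maps. -/
structure IsoclinismData (A : Type u) (B : Type v) [SkewBrace A] [SkewBrace B]
    (I : Set A) (J : Set B) (ξ θ : A → B) : Prop where
  xi_resp : ∀ a a' : A, cosetRel I a a' ↔ cosetRel J (ξ a) (ξ a')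
  xi_surj : ∀ b : B, ∃ a : A, cosetRel J b (ξ a)
  xi_dmul : ∀ a a' : A, cosetRel J (dmul (ξ a) (ξ a')) (ξ (dmul a a'))
  xi_cmul : ∀ a a' : A, cosetRel J (cmul (ξ a) (ξ a')) (ξ (cmul a a'))
  theta_maps : ∀ x ∈ Gamma A 2, θ x ∈ Gamma B 2
  theta_inj : ∀ x ∈ Gamma A 2, ∀ y ∈ Gamma A 2, θ x = θ y → x = y
  theta_surj : ∀ y ∈ Gamma B 2, ∃ x ∈ Gamma A 2, θ x = y
  theta_dmul : ∀ x ∈ Gamma A 2, ∀ y ∈ Gamma A 2, θ (dmul x y) = dmul (θ x) (θ y)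
  theta_cmul : ∀ x ∈ Gamma A 2, ∀ y ∈ Gamma A 2, θ (cmul x y) = cmul (θ x) (θ y)
  compat_dcomm : ∀ a₁ a₂ : A, ∀ b₁ b₂ : B, cosetRel J b₁ (ξ a₁) → cosetRel J b₂ (ξ a₂) →
    θ (dcomm a₁ a₂) = dcomm b₁ b₂
  compat_star : ∀ a₁ a₂ : A, ∀ b₁ b₂ : B, cosetRel J b₁ (ξ a₁) → cosetRel J b₂ (ξ a₂) →
    θ (bstar a₁ a₂) = bstar b₁ b₂

/-- Isoclinism (1-isoclinism) of skew left braces. -/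
def Isoclinic (A : Type u) (B : Type v) [SkewBrace A] [SkewBrace B] : Prop :=
  ∃ ξ θ : A → B, IsoclinismData A B (AnnS A 1) (AnnS B 1) ξ θ

/-- The data of an `n`-isoclinism of skew braces: `ξ` induces a brace isomorphism
`A/Ann_n(A) → B/Ann_n(B)` and `θ` restricts to a brace isomorphism `A_{(n)} → B_{(n)}`
commuting with all brace commutator word maps of degree `n`. -/
structure IsoclinismDataN (A : Type u) (B : Type v) [SkewBrace A] [SkewBrace B]
    (n : ℕ) (ξ θ : A → B) : Prop where
  xi_resp : ∀ a a' : A, cosetRel (AnnS A n) a a' ↔ cosetRel (AnnS B n) (ξ a) (ξ a')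
  xi_surj : ∀ b : B, ∃ a : A, cosetRel (AnnS B n) b (ξ a)
  xi_dmul : ∀ a a' : A, cosetRel (AnnS B n) (dmul (ξ a) (ξ a')) (ξ (dmul a a'))
  xi_cmul : ∀ a a' : A, cosetRel (AnnS B n) (cmul (ξ a) (ξ a')) (ξ (cmul a a'))
  theta_maps : ∀ x ∈ Asub A n, θ x ∈ Asub B n
  theta_inj : ∀ x ∈ Asub A n, ∀ y ∈ Asub A n, θ x = θ y → x = y
  theta_surj : ∀ y ∈ Asub B n, ∃ x ∈ Asub A n, θ x = y
  theta_dmul : ∀ x ∈ Asub A n, ∀ y ∈ Asub A n, θ (dmul x y) = dmul (θ x) (θ y)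
  theta_cmul : ∀ x ∈ Asub A n, ∀ y ∈ Asub A n, θ (cmul x y) = cmul (θ x) (θ y)
  compat : ∀ (e : ℕ → BWord) (a : ℕ → A) (b : ℕ → B),
    (∀ i : ℕ, i ≤ n → cosetRel (AnnS B n) (b i) (ξ (a i))) →
    θ (evalW e a n) = evalW e b n

/-- `n`-isoclinism of skew left braces. -/
def IsoclinicN (A : Type u) (B : Type v) [SkewBrace A] [SkewBrace B] (n : ℕ) : Prop :=
  ∃ ξ θ : A → B, IsoclinismDataN A B n ξ θ

/-- The product set `S · T = {s · t : s ∈ S, t ∈ T}` in `(A,·)`. -/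
def setDProd (S T : Set A) : Set A := {x | ∃ s ∈ S, ∃ t ∈ T, x = dmul s t}

/-- The product set `S ∘ T = {s ∘ t : s ∈ S, t ∈ T}` in `(A,∘)`. -/
def setCProd (S T : Set A) : Set A := {x | ∃ s ∈ S, ∃ t ∈ T, x = cmul s t}

/-- The skew brace structure on a sub-skew brace. -/
def subBrace (S : Set A) (h : IsSubBrace A S) : SkewBrace S where
  dmul x y := ⟨dmul x.1 y.1, h.dmul_mem x.2 y.2⟩
  ident := ⟨ident, h.ident_mem⟩
  dinv x := ⟨dinv x.1, h.dinv_mem x.2⟩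
  cmul x y := ⟨cmul x.1 y.1, h.cmul_mem x.2 y.2⟩
  cinv x := ⟨cinv x.1, h.cinv_mem x.2⟩
  dmul_assoc a b c := Subtype.ext (dmul_assoc a.1 b.1 c.1)
  ident_dmul a := Subtype.ext (ident_dmul a.1)
  dmul_ident a := Subtype.ext (dmul_ident a.1)
  dinv_dmul a := Subtype.ext (dinv_dmul a.1)
  dmul_dinv a := Subtype.ext (dmul_dinv a.1)
  cmul_assoc a b c := Subtype.ext (cmul_assoc a.1 b.1 c.1)
  ident_cmul a := Subtype.ext (ident_cmul a.1)
  cmul_ident a := Subtype.ext (cmul_ident a.1)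
  cinv_cmul a := Subtype.ext (cinv_cmul a.1)
  cmul_cinv a := Subtype.ext (cmul_cinv a.1)
  compat a b c := Subtype.ext (compat a.1 b.1 c.1)

/-- The direct product of two skew braces, with componentwise operations. -/
instance prodBrace (A : Type u) (B : Type v) [SkewBrace A] [SkewBrace B] :
    SkewBrace (A × B) where
  dmul p q := (dmul p.1 q.1, dmul p.2 q.2)
  ident := (ident, ident)
  dinv p := (dinv p.1, dinv p.2)
  cmul p q := (cmul p.1 q.1, cmul p.2 q.2)
  cinv p := (cinv p.1, cinv p.2)
  dmul_assoc a b c := Prod.ext_iff.mpr ⟨dmul_assoc _ _ _, dmul_assoc _ _ _⟩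
  ident_dmul a := Prod.ext_iff.mpr ⟨ident_dmul _, ident_dmul _⟩
  dmul_ident a := Prod.ext_iff.mpr ⟨dmul_ident _, dmul_ident _⟩
  dinv_dmul a := Prod.ext_iff.mpr ⟨dinv_dmul _, dinv_dmul _⟩
  dmul_dinv a := Prod.ext_iff.mpr ⟨dmul_dinv _, dmul_dinv _⟩
  cmul_assoc a b c := Prod.ext_iff.mpr ⟨cmul_assoc _ _ _, cmul_assoc _ _ _⟩
  ident_cmul a := Prod.ext_iff.mpr ⟨ident_cmul _, ident_cmul _⟩
  cmul_ident a := Prod.ext_iff.mpr ⟨cmul_ident _, cmul_ident _⟩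
  cinv_cmul a := Prod.ext_iff.mpr ⟨cinv_cmul _, cinv_cmul _⟩
  cmul_cinv a := Prod.ext_iff.mpr ⟨cmul_cinv _, cmul_cinv _⟩
  compat a b c := Prod.ext_iff.mpr ⟨compat _ _ _, compat _ _ _⟩

end SkewBrace

namespace SkewBrace

variable {A : Type u} [SkewBrace A]

/-- The group `(A,·)`. -/
abbrev dotGroup (A : Type u) [SkewBrace A] : Group A :=
  letI : Mul A := ⟨dmul⟩
  letI : One A := ⟨ident⟩
  letI : Inv A := ⟨dinv⟩
  Group.ofLeftAxioms dmul_assoc ident_dmul dinv_dmul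

theorem lam_dmul (a x y : A) : lam a (dmul x y) = dmul (lam a x) (lam a y) := by
  simp only [lam, compat, dmul_assoc]

theorem lam_ident (a : A) : lam a ident = ident := by
  rw [lam, cmul_ident, dinv_dmul]

theorem lam_dinv (a x : A) : lam a (dinv x) = dinv (lam a x) := by
  let := dotGroup A
  have h : lam a (dinv x) * lam a x = 1 := by
    change dmul (lam a (dinv x)) (lam a x) = ident
    rw [← lam_dmul, dinv_dmul, lam_ident]
  exact eq_inv_of_mul_eq_one_left h

theorem bstar_ident (a : A) : bstar a ident = ident := by
  rw [bstar, lam_ident, dmul_dinv]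

theorem bstar_dmul (a x y : A) :
    bstar a (dmul x y) = dmul (bstar a x) (dmul (dmul x (bstar a y)) (dinv x)) := by
  let := dotGroup A
  simp only [bstar, lam_dmul]
  change lam a x * lam a y * (x * y)⁻¹ = lam a x * x⁻¹ * (x * (lam a y * y⁻¹) * x⁻¹)
  group

theorem bstar_dinv (a x : A) :
    bstar a (dinv x) = dmul (dmul (dinv x) (dinv (bstar a x))) (dinv (dinv x)) := by
  let := dotGroup A
  simp only [bstar, lam_dinv]
  change (lam a x)⁻¹ * x⁻¹⁻¹ = x⁻¹ * (lam a x * x⁻¹)⁻¹ * x⁻¹⁻¹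
  group

theorem dcomm_ident (a : A) : dcomm a ident = ident := by
  let := dotGroup A
  change a * 1 * a⁻¹ * 1⁻¹ = 1
  group

theorem dcomm_dmul (a x y : A) :
    dcomm a (dmul x y) = dmul (dcomm a x) (dmul (dmul x (dcomm a y)) (dinv x)) := by
  let := dotGroup A
  change a * (x * y) * a⁻¹ * (x * y)⁻¹ = a * x * a⁻¹ * x⁻¹ * (x * (a * y * a⁻¹ * y⁻¹) * x⁻¹)
  group

theorem dcomm_dinv (a x : A) :
    dcomm a (dinv x) = dmul (dmul (dinv x) (dinv (dcomm a x))) (dinv (dinv x)) := by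
  let := dotGroup A
  change a * x⁻¹ * a⁻¹ * x⁻¹⁻¹ = x⁻¹ * (a * x * a⁻¹ * x⁻¹)⁻¹ * x⁻¹⁻¹
  group

theorem dinv_dcomm (a b : A) : dinv (dcomm a b) = dcomm b a := by
  let := dotGroup A
  change (a * b * a⁻¹ * b⁻¹)⁻¹ = b * a * b⁻¹ * a⁻¹
  group

theorem dconj_eq_dcomm_dmul (a x : A) :
    dmul (dmul a x) (dinv a) = dmul (dcomm a x) x := by
  let := dotGroup A
  change a * x * a⁻¹ = a * x * a⁻¹ * x⁻¹ * x
  group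

theorem dconj_ident (a : A) : dmul (dmul a ident) (dinv a) = ident := by
  rw [dmul_ident, dmul_dinv]

theorem dconj_dmul (a x y : A) : dmul (dmul a (dmul x y)) (dinv a) =
    dmul (dmul (dmul a x) (dinv a)) (dmul (dmul a y) (dinv a)) := by
  let := dotGroup A
  change a * (x * y) * a⁻¹ = a * x * a⁻¹ * (a * y * a⁻¹)
  group

theorem dconj_dinv (a x : A) :
    dmul (dmul a (dinv x)) (dinv a) = dinv (dmul (dmul a x) (dinv a)) := by
  let := dotGroup A
  change a * x⁻¹ * a⁻¹ = (a * x * a⁻¹)⁻¹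
  group

theorem dcl_subset_dcl {S T : Set A} (h : S ⊆ dcl T) : dcl S ⊆ dcl T := by
  intro x hx
  induction hx with
  | mem hx => exact h hx
  | one => exact dclosure.one
  | mul _ _ ihx ihy => exact dclosure.mul ihx ihy
  | inv _ ih => exact dclosure.inv ih

theorem dconj_mem_dcl {S : Set A} (h : ∀ a, ∀ x ∈ S, dcomm a x ∈ dcl S) (a : A) {x : A}
    (hx : x ∈ dcl S) : dmul (dmul a x) (dinv a) ∈ dcl S := by
  induction hx with
  | mem hx =>
    rw [dconj_eq_dcomm_dmul]
    exact dclosure.mul (h a _ hx) (dclosure.mem hx)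
  | one =>
    rw [dconj_ident]
    exact dclosure.one
  | mul _ _ ihx ihy =>
    rw [dconj_dmul]
    exact dclosure.mul ihx ihy
  | inv _ ih =>
    rw [dconj_dinv]
    exact dclosure.inv ih

/-- A map that is a crossed homomorphism for conjugation in `(A,·)` sends the subgroup generated
by `S` into a normal subgroup as soon as it sends `S` there. -/
theorem map_mem_dcl_of_crossed {S T : Set A} {f : A → A} (h1 : f ident = ident)
    (hmul : ∀ x y, f (dmul x y) = dmul (f x) (dmul (dmul x (f y)) (dinv x)))
    (hinv : ∀ x, f (dinv x) = dmul (dmul (dinv x) (dinv (f x))) (dinv (dinv x)))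
    (hT : ∀ a, ∀ x ∈ dcl T, dmul (dmul a x) (dinv a) ∈ dcl T)
    (hS : ∀ x ∈ S, f x ∈ dcl T) {x : A} (hx : x ∈ dcl S) : f x ∈ dcl T := by
  induction hx with
  | mem hx => exact hS _ hx
  | one =>
    rw [h1]
    exact dclosure.one
  | mul _ _ ihx ihy =>
    rw [hmul]
    exact dclosure.mul ihx (hT _ _ ihy)
  | inv _ ih =>
    rw [hinv]
    exact hT _ _ (dclosure.inv ih)

theorem evalX_evalW (ε : BWord) (c : A) (e : ℕ → BWord) (a : ℕ → A) (s : ℕ) :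
    evalX ε c (evalW e a s) =
      evalW (fun i => Nat.casesOn i ε e) (fun i => Nat.casesOn i c a) (s + 1) := rfl

theorem evalX_evalW_mem_Asub (ε : BWord) (c : A) (e : ℕ → BWord) (a : ℕ → A) {s t : ℕ}
    (h : t ≤ s + 1) : evalX ε c (evalW e a s) ∈ Asub A t :=
  dclosure.mem ⟨s + 1, h, _, _, evalX_evalW ε c e a s⟩

theorem dconj_mem_Asub (t : ℕ) (a : A) {x : A} (hx : x ∈ Asub A t) :
    dmul (dmul a x) (dinv a) ∈ Asub A t := by
  refine dconj_mem_dcl ?_ a hx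
  rintro c _ ⟨s, hs, e, b, rfl⟩
  exact evalX_evalW_mem_Asub BWord.g c e b (Nat.le_succ_of_le hs)

theorem bstar_mem_Asub {t : ℕ} (a : A) {x : A} (hx : x ∈ Asub A t) :
    bstar a x ∈ Asub A (t + 1) := by
  refine map_mem_dcl_of_crossed (bstar_ident a) (bstar_dmul a) (bstar_dinv a)
    (fun c _ hy => dconj_mem_Asub (t + 1) c hy) ?_ hx
  rintro _ ⟨s, hs, e, b, rfl⟩
  exact evalX_evalW_mem_Asub BWord.s a e b (Nat.succ_le_succ hs)

theorem dcomm_mem_Asub {t : ℕ} (a : A) {x : A} (hx : x ∈ Asub A t) :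
    dcomm a x ∈ Asub A (t + 1) := by
  refine map_mem_dcl_of_crossed (dcomm_ident a) (dcomm_dmul a) (dcomm_dinv a)
    (fun c _ hy => dconj_mem_Asub (t + 1) c hy) ?_ hx
  rintro _ ⟨s, hs, e, b, rfl⟩
  exact evalX_evalW_mem_Asub BWord.g a e b (Nat.succ_le_succ hs)

theorem GammaBar_succ_subset_Asub (t : ℕ) : GammaBar A (t + 1) ⊆ Asub A t := by
  induction t with
  | zero => exact fun x _ => dclosure.mem ⟨0, le_rfl, fun _ => BWord.g, fun _ => x, rfl⟩
  | succ t ih =>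
    refine dcl_subset_dcl ?_
    rintro _ (⟨a, -, x, hx, rfl⟩ | ⟨a, -, x, hx, rfl⟩)
    · exact bstar_mem_Asub a (ih hx)
    · exact dcomm_mem_Asub a (ih hx)

theorem evalX_mem_Gamma {t : ℕ} (ε : BWord) (a : A) {x : A} (hx : x ∈ Gamma A (t + 1)) :
    evalX ε a x ∈ Gamma A (t + 2) := by
  have hcomm : dcomm a x ∈ Gamma A (t + 2) := dclosure.mem (Or.inr ⟨a, trivial, x, hx, rfl⟩)
  cases ε with
  | g => exact hcomm
  | gbar =>
    change dcomm x a ∈ _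
    rw [← dinv_dcomm]
    exact dclosure.inv hcomm
  | s => exact dclosure.mem (Or.inl (Or.inl ⟨a, trivial, x, hx, rfl⟩))
  | sbar => exact dclosure.mem (Or.inl (Or.inr ⟨x, hx, a, trivial, rfl⟩))

theorem evalW_mem_Gamma (e : ℕ → BWord) (a : ℕ → A) (s : ℕ) :
    evalW e a s ∈ Gamma A (s + 1) := by
  induction s generalizing e a with
  | zero => trivial
  | succ s ih => exact evalX_mem_Gamma _ _ (ih _ _)

theorem Gamma_succ_subset (n : ℕ) : Gamma A (n + 1) ⊆ Gamma A n := by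
  induction n with
  | zero => exact Set.subset_univ _
  | succ n ih =>
    cases n with
    | zero => exact Set.subset_univ _
    | succ n =>
      refine dcl_subset_dcl ?_
      rintro _ ((⟨a, -, x, hx, rfl⟩ | ⟨x, hx, a, -, rfl⟩) | ⟨a, -, x, hx, rfl⟩)
      · exact evalX_mem_Gamma BWord.s a (ih hx)
      · exact evalX_mem_Gamma BWord.sbar a (ih hx)
      · exact evalX_mem_Gamma BWord.g a (ih hx)

theorem Gamma_antitone : Antitone (Gamma A) := antitone_nat_of_succ_le Gamma_succ_subset

theorem Asub_subset_Gamma_succ (t : ℕ) : Asub A t ⊆ Gamma A (t + 1) := by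
  cases t with
  | zero => exact Set.subset_univ _
  | succ t =>
    refine dcl_subset_dcl ?_
    rintro _ ⟨s, hs, e, a, rfl⟩
    exact Gamma_antitone (Nat.succ_le_succ hs) (evalW_mem_Gamma e a s)

end SkewBrace

open SkewBrace in
/-- For every `n ≥ 1` one has `Γ̄_n(A) ⊆ A_{(n-1)} ⊆ Γ_n(A)`. -/
theorem gammaBar_subset_asub_subset_gamma (A : Type u) [SkewBrace A] (n : ℕ) (hn : 1 ≤ n) :
    GammaBar A n ⊆ Asub A (n - 1) ∧ Asub A (n - 1) ⊆ Gamma A n := by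
  obtain ⟨t, rfl⟩ := Nat.exists_eq_add_of_le' hn
  exact ⟨GammaBar_succ_subset_Asub t, Asub_subset_Gamma_succ t⟩
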